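/- Let A be a unital C*-algebra, a ∈ A a positive element, and f a hermitian (self-adjoint) continuous linear functional on A. Then r_a(f) equals the norm of the continuous linear functional x ↦ f(√a · x · √a), where √a denotes the positive square root of a. -/

import Mathlib

open scoped ComplexOrder NNReal

variable {A : Type*} [CStarAlgebra A] [PartialOrder A] [StarOrderedRing A]

/-- A continuous linear functional on a C*-algebra is positive if it is nonnegative on
positive elements (using the complex order). -/
def IsPosFunctional {A : Type*} [CStarAlgebra A] [PartialOrder A] [StarOrderedRing A]
    (f : A →L[ℂ] ℂ) : Prop :=
  ∀ x : A, 0 ≤ x → 0 ≤ f x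

/-- A continuous linear functional is hermitian if `f (star x) = conj (f x)` for all `x`. -/
def IsHermitianFunctional {A : Type*} [CStarAlgebra A] (f : A →L[ℂ] ℂ) : Prop :=
  ∀ x : A, f (star x) = starRingEnd ℂ (f x)

/-- The seminorm `r_a` associated with a positive element `a`:
`r_a(f) = inf { f₁(a) + f₂(a) | f = f₁ - f₂, f₁, f₂ positive }`. -/
noncomputable def rSeminorm {A : Type*} [CStarAlgebra A] [PartialOrder A] [StarOrderedRing A]
    (a : A) (f : A →L[ℂ] ℂ) : ℝ :=
  sInf { r : ℝ | ∃ f₁ f₂ : A →L[ℂ] ℂ, IsPosFunctional f₁ ∧ IsPosFunctional f₂ ∧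
    f = f₁ - f₂ ∧ (r : ℂ) = f₁ a + f₂ a }

open ComplexStarModule in
theorem aux_extend {A : Type*} [CStarAlgebra A] [PartialOrder A] [StarOrderedRing A]
    (h : selfAdjoint A →ₗ[ℝ] ℝ) (hh : ∀ x : selfAdjoint A, 0 ≤ (x : A) → 0 ≤ h x) :
    ∃ g : A →L[ℂ] ℂ, IsPosFunctional g ∧ ∀ x : selfAdjoint A, g (x : A) = (h x : ℂ) := by
  let g0 : A →ₗ[ℂ] ℂ := Module.Dual.extendRCLike (𝕜 := ℂ) (h ∘ₗ realPart)
  have hg0 : ∀ x : selfAdjoint A, g0 (x : A) = (h x : ℂ) := by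
    intro x
    change Module.Dual.extendRCLike (𝕜 := ℂ) (h ∘ₗ realPart) (x : A) = _
    rw [Module.Dual.extendRCLike_apply]
    have h2 : ℑ (x : A) = 0 := x.2.imaginaryPart
    simp [realPart_I_smul, h2]
  have hpos : ∀ x : A, 0 ≤ x → 0 ≤ g0 x := by
    intro x hx
    have := hg0 ⟨x, IsSelfAdjoint.of_nonneg hx⟩
    simp only at this
    rw [this]
    exact_mod_cast hh _ hx
  let gp : A →ₚ[ℂ] ℂ := PositiveLinearMap.mk₀ g0 hpos
  obtain ⟨C, hC⟩ := PositiveLinearMap.exists_norm_apply_le gp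
  exact ⟨g0.mkContinuous C hC, fun x hx => hpos x hx, fun x => hg0 x⟩

theorem aux_norm_le {A : Type*} [CStarAlgebra A] [PartialOrder A] [StarOrderedRing A]
    [Nontrivial A] (x : A) (hx : IsSelfAdjoint x) (t : ℝ)
    (h1 : 0 ≤ x + algebraMap ℝ A t) (h2 : 0 ≤ -x + algebraMap ℝ A t) : ‖x‖ ≤ t := by
  have h2' : x ≤ algebraMap ℝ A t := by
    rw [neg_add_eq_sub] at h2; exact sub_nonneg.1 h2
  have h1' : algebraMap ℝ A (-t) ≤ x := by
    rw [map_neg]; exact neg_le_iff_add_nonneg.2 h1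
  rw [le_algebraMap_iff_spectrum_le (ha := hx)] at h2'
  rw [algebraMap_le_iff_le_spectrum (ha := hx)] at h1'
  rcases CStarAlgebra.norm_or_neg_norm_mem_spectrum (ha := hx) with h | h
  · exact h2' _ h
  · have := h1' _ h
    linarith

theorem aux_ext_sa {A : Type*} [CStarAlgebra A] (f g : A →L[ℂ] ℂ)
    (h : ∀ x : selfAdjoint A, f x = g x) : f = g := by
  ext x
  rw [← realPart_add_I_smul_imaginaryPart x]
  simp [h]

theorem aux_im {A : Type*} [CStarAlgebra A] (f : A →L[ℂ] ℂ)
    (hf : IsHermitianFunctional f) (x : A) (hx : IsSelfAdjoint x) : f x = ((f x).re : ℂ) := by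
  have := hf x
  rw [hx.star_eq] at this
  exact (Complex.conj_eq_iff_re.1 this.symm).symm

theorem aux_jordan {A : Type*} [CStarAlgebra A] [PartialOrder A] [StarOrderedRing A]
    (f : A →L[ℂ] ℂ) (hf : IsHermitianFunctional f) :
    ∃ f₁ f₂ : A →L[ℂ] ℂ, IsPosFunctional f₁ ∧ IsPosFunctional f₂ ∧ f = f₁ - f₂ ∧
      (f₁ 1).re + (f₂ 1).re ≤ ‖f‖ := by
  rcases subsingleton_or_nontrivial A with hA | hA
  · refine ⟨0, 0, fun x _ => by simp, fun x _ => by simp, ?_, by simp⟩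
    ext x
    simp [Subsingleton.elim x 0]
  let s : PointedCone ℝ (selfAdjoint A × selfAdjoint A × ℝ) :=
    { carrier := {p | 0 ≤ (p.1 : A) + algebraMap ℝ A p.2.2 ∧
        0 ≤ (p.2.1 : A) + algebraMap ℝ A p.2.2}
      add_mem' := by
        rintro p q ⟨h1, h2⟩ ⟨h3, h4⟩
        refine ⟨?_, ?_⟩
        · have := add_nonneg h1 h3
          simpa [add_add_add_comm] using this
        · have := add_nonneg h2 h4
          simpa [add_add_add_comm] using this
      zero_mem' := by simp
      smul_mem' := by
        rintro c p ⟨h1, h2⟩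
        refine ⟨?_, ?_⟩
        · have := smul_nonneg c.2 h1
          change 0 ≤ (((c : ℝ) • p.1 : selfAdjoint A) : A) + algebraMap ℝ A ((c : ℝ) * p.2.2)
          rw [map_mul, ← Algebra.smul_def, selfAdjoint.val_smul, ← smul_add]
          exact this
        · have := smul_nonneg c.2 h2
          change 0 ≤ (((c : ℝ) • p.2.1 : selfAdjoint A) : A) + algebraMap ℝ A ((c : ℝ) * p.2.2)
          rw [map_mul, ← Algebra.smul_def, selfAdjoint.val_smul, ← smul_add]
          exact this }
  let φ : (selfAdjoint A × selfAdjoint A × ℝ) →ₗ[ℝ] ℝ :=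
    { toFun := fun p => (f (p.1 : A)).re + p.2.2 * ‖f‖
      map_add' := by intro p q; simp; ring
      map_smul' := by intro c p; simp; ring }
  let D : Submodule ℝ (selfAdjoint A × selfAdjoint A × ℝ) :=
    { carrier := {p | p.2.1 = -p.1}
      add_mem' := by
        intro p q (hp : p.2.1 = -p.1) (hq : q.2.1 = -q.1)
        change p.2.1 + q.2.1 = -(p.1 + q.1)
        rw [hp, hq]; abel
      zero_mem' := by simp
      smul_mem' := by
        intro c p (hp : p.2.1 = -p.1)
        change c • p.2.1 = -(c • p.1)
        rw [hp, smul_neg] }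
  obtain ⟨F, hF1, hF2⟩ := riesz_extension s ⟨D, φ ∘ₗ D.subtype⟩ (by
    rintro ⟨⟨x, y, t⟩, (hp : y = -x)⟩ ⟨h1, h2⟩
    subst hp
    have hn : ‖(x : A)‖ ≤ t := aux_norm_le (x : A) x.2 t h1 (by simpa using h2)
    change 0 ≤ (f (x : A)).re + t * ‖f‖
    have h3 : |(f (x : A)).re| ≤ ‖f‖ * ‖(x : A)‖ := (Complex.abs_re_le_norm _).trans (f.le_opNorm _)
    have h4 := neg_abs_le (f (x : A)).re
    nlinarith [norm_nonneg f]) (by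
    rintro ⟨x, y, t⟩
    refine ⟨⟨(0, 0, ‖(x : A)‖ + ‖(y : A)‖ - t), by simp [D]⟩, ?_⟩
    have hx : -(algebraMap ℝ A ‖(x : A)‖) ≤ x := IsSelfAdjoint.neg_algebraMap_norm_le_self x.2
    have hy : -(algebraMap ℝ A ‖(y : A)‖) ≤ y := IsSelfAdjoint.neg_algebraMap_norm_le_self y.2
    have hx0 : 0 ≤ algebraMap ℝ A ‖(x : A)‖ := algebraMap_nonneg A (norm_nonneg _)
    have hy0 : 0 ≤ algebraMap ℝ A ‖(y : A)‖ := algebraMap_nonneg A (norm_nonneg _)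
    refine ⟨?_, ?_⟩
    · have := add_nonneg (neg_le_iff_add_nonneg.1 hx) hy0
      simpa [add_assoc] using this
    · have := add_nonneg (neg_le_iff_add_nonneg.1 hy) hx0
      simpa [add_assoc, add_comm (algebraMap ℝ A ‖(y : A)‖)] using this)
  have hF1' : ∀ (x : selfAdjoint A) (t : ℝ), F (x, -x, t) = (f (x : A)).re + t * ‖f‖ :=
    fun x t => hF1 ⟨(x, -x, t), rfl⟩
  obtain ⟨f₁, hf₁, h₁⟩ := aux_extend (F ∘ₗ LinearMap.inl ℝ _ _) (by
    intro x hx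
    exact hF2 _ ⟨by simpa using hx, by simp⟩)
  obtain ⟨f₂, hf₂, h₂⟩ := aux_extend (F ∘ₗ LinearMap.inr ℝ _ _ ∘ₗ LinearMap.inl ℝ _ _) (by
    intro x hx
    exact hF2 _ ⟨by simp, by simpa using hx⟩)
  replace h₁ : ∀ x : selfAdjoint A, f₁ (x : A) = (F (x, 0, 0) : ℂ) := h₁
  replace h₂ : ∀ x : selfAdjoint A, f₂ (x : A) = (F (0, x, 0) : ℂ) := h₂
  refine ⟨f₁, f₂, hf₁, hf₂, ?_, ?_⟩
  · apply aux_ext_sa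
    intro x
    rw [aux_im f hf _ x.2, sub_apply, h₁, h₂]
    have e := hF1' x 0
    have e2 : ((x, -x, 0) : selfAdjoint A × selfAdjoint A × ℝ) = (x, 0, 0) - (0, x, 0) := by ext <;> simp
    rw [e2, map_sub] at e
    simp at e
    simp [← e]
  · have e1 := h₁ 1
    have e2 := h₂ 1
    simp only [selfAdjoint.val_one] at e1 e2
    rw [e1, e2]
    have e3 : 0 ≤ F (-1, -1, 1) := hF2 _ ⟨by simp, by simp⟩
    have e4 := hF1' 0 1
    have e5 : ((-1, -1, 1) : selfAdjoint A × selfAdjoint A × ℝ) = (0, -0, 1) - (1, 0, 0) - (0, 1, 0) := by ext <;> simp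
    rw [e5, map_sub, map_sub, e4] at e3
    simp at e3 ⊢
    linarith

theorem aux_herm_norm {A : Type*} [CStarAlgebra A]
    (g : A →L[ℂ] ℂ) (hg : IsHermitianFunctional g) (C : ℝ) (hC : 0 ≤ C)
    (h : ∀ x : A, IsSelfAdjoint x → (g x).re ≤ C * ‖x‖) : ‖g‖ ≤ C := by
  refine g.opNorm_le_bound hC fun x => ?_
  by_cases h0 : g x = 0
  · rw [h0, norm_zero]; positivity
  let w : ℂ := (starRingEnd ℂ (g x)) / ‖g x‖
  have hn : (‖g x‖ : ℂ) ≠ 0 := by simpa using h0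
  have hw : ‖w‖ = 1 := by simp [w, h0]
  have hwg : g (w • x) = ‖g x‖ := by
    rw [map_smul, smul_eq_mul]
    simp only [w]
    rw [div_mul_eq_mul_div, Complex.conj_mul', sq]
    field_simp
  have hre : (g (realPart (w • x) : A)) = ‖g x‖ := by
    rw [realPart_apply_coe, ← Complex.coe_smul, map_smul, map_add, hg, hwg, Complex.conj_ofReal]
    simp
    ring
  have := h _ (realPart (w • x)).2
  rw [hre, Complex.ofReal_re] at this
  refine this.trans ?_
  gcongr
  have hh : ‖(realPart (w • x) : A)‖ ≤ ‖w • x‖ := by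
    rw [realPart_apply_coe, norm_smul]
    have h1 := norm_add_le (w • x) (star (w • x))
    rw [norm_star] at h1
    norm_num at h1 ⊢
    linarith
  refine hh.trans ?_
  rw [norm_smul, hw, one_mul]

theorem aux_conj_herm {A : Type*} [CStarAlgebra A]
    (f : A →L[ℂ] ℂ) (hf : IsHermitianFunctional f) (s : A) (hs : IsSelfAdjoint s) :
    IsHermitianFunctional (f.comp ((ContinuousLinearMap.mul ℂ A s).comp
        ((ContinuousLinearMap.mul ℂ A).flip s))) := by
  intro x
  have := hf (s * (x * s))
  simpa [hs.star_eq, mul_assoc] using this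

theorem aux_conj_pos {A : Type*} [CStarAlgebra A] [PartialOrder A] [StarOrderedRing A]
    (f : A →L[ℂ] ℂ) (hf : IsPosFunctional f) (s : A) (hs : IsSelfAdjoint s) :
    IsPosFunctional (f.comp ((ContinuousLinearMap.mul ℂ A s).comp
        ((ContinuousLinearMap.mul ℂ A).flip s))) := by
  intro x hx
  have := hf _ (hs.conjugate_nonneg hx)
  simpa [mul_assoc] using this

theorem aux_pos_le {A : Type*} [CStarAlgebra A] [PartialOrder A] [StarOrderedRing A]
    (f : A →L[ℂ] ℂ) (hf : IsPosFunctional f) (x : A) (hx : IsSelfAdjoint x) :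
    |(f x).re| ≤ (f 1).re * ‖x‖ := by
  have h1 := hf _ (sub_nonneg.2 (IsSelfAdjoint.le_algebraMap_norm_self hx))
  have h2 := hf _ (sub_nonneg.2 (IsSelfAdjoint.neg_algebraMap_norm_le_self hx))
  have e : f (algebraMap ℝ A ‖x‖) = ‖x‖ * f 1 := by
    rw [Algebra.algebraMap_eq_smul_one, ← Complex.coe_smul, map_smul, smul_eq_mul]
  rw [map_sub, e] at h1
  rw [map_sub, map_neg, e] at h2
  have h1' := (Complex.le_def.1 h1).1
  have h2' := (Complex.le_def.1 h2).1
  simp at h1' h2'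
  rw [abs_le]
  constructor <;> nlinarith

theorem aux_lower {A : Type*} [CStarAlgebra A] [PartialOrder A] [StarOrderedRing A]
    (a : A) (ha : 0 ≤ a) (f f₁ f₂ : A →L[ℂ] ℂ) (hf : IsHermitianFunctional f)
    (h₁ : IsPosFunctional f₁) (h₂ : IsPosFunctional f₂) (h : f = f₁ - f₂) :
    ‖f.comp ((ContinuousLinearMap.mul ℂ A (CFC.sqrt a)).comp
        ((ContinuousLinearMap.mul ℂ A).flip (CFC.sqrt a)))‖ ≤ (f₁ a).re + (f₂ a).re := by
  have hs : IsSelfAdjoint (CFC.sqrt a) := IsSelfAdjoint.of_nonneg (CFC.sqrt_nonneg a)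
  have p1 := (Complex.le_def.1 (h₁ a ha)).1
  have p2 := (Complex.le_def.1 (h₂ a ha)).1
  apply aux_herm_norm _ (aux_conj_herm f hf _ hs) _ (by simpa using add_nonneg p1 p2)
  intro x hx
  have q1 := abs_le.1 (aux_pos_le _ (aux_conj_pos f₁ h₁ _ hs) x hx)
  have q2 := abs_le.1 (aux_pos_le _ (aux_conj_pos f₂ h₂ _ hs) x hx)
  simp [CFC.sqrt_mul_sqrt_self a ha] at q1 q2
  subst h
  simp
  linarith [q1.2, q2.1]

theorem aux_upper {A : Type*} [CStarAlgebra A] [PartialOrder A] [StarOrderedRing A]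
    (a : A) (ha : IsStrictlyPositive a) (f : A →L[ℂ] ℂ) (hf : IsHermitianFunctional f) :
    ∃ f₁ f₂ : A →L[ℂ] ℂ, IsPosFunctional f₁ ∧ IsPosFunctional f₂ ∧ f = f₁ - f₂ ∧
      (f₁ a).re + (f₂ a).re ≤ ‖f.comp ((ContinuousLinearMap.mul ℂ A (CFC.sqrt a)).comp
        ((ContinuousLinearMap.mul ℂ A).flip (CFC.sqrt a)))‖ := by
  have hs : IsSelfAdjoint (CFC.sqrt a) := IsSelfAdjoint.of_nonneg (CFC.sqrt_nonneg a)
  obtain ⟨u, hu⟩ := CFC.isUnit_sqrt_iff_isStrictlyPositive.2 ha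
  have hus : star u = u := Units.ext (by simpa [hu] using hs.star_eq)
  have hv : IsSelfAdjoint ((u⁻¹ : Aˣ) : A) := by
    rw [IsSelfAdjoint, ← Units.coe_star, star_inv, hus]
  obtain ⟨g₁, g₂, k₁, k₂, e, hle⟩ := aux_jordan _ (aux_conj_herm f hf _ hs)
  have haa : a = (u : A) * u := by rw [hu, CFC.sqrt_mul_sqrt_self a ha.nonneg]
  refine ⟨_, _, aux_conj_pos g₁ k₁ _ hv, aux_conj_pos g₂ k₂ _ hv, ?_, ?_⟩
  · rw [← ContinuousLinearMap.sub_comp, ← e]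
    ext x
    simp [← hu, mul_assoc]
  · refine le_trans (le_of_eq ?_) hle
    simp [haa, mul_assoc]

theorem rSeminorm_eq_norm_sqrt_conj (a : A) (ha : 0 ≤ a) (f : A →L[ℂ] ℂ)
    (hf : IsHermitianFunctional f) :
    rSeminorm a f =
      ‖f.comp ((ContinuousLinearMap.mul ℂ A (CFC.sqrt a)).comp
        ((ContinuousLinearMap.mul ℂ A).flip (CFC.sqrt a)))‖ := by
  have key : ∀ ε : ℝ, 0 < ε → ∃ f₁ f₂ : A →L[ℂ] ℂ, IsPosFunctional f₁ ∧ IsPosFunctional f₂ ∧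
      f = f₁ - f₂ ∧ (f₁ a).re + (f₂ a).re ≤
      ‖f.comp ((ContinuousLinearMap.mul ℂ A (CFC.sqrt (a + algebraMap ℝ A ε))).comp
        ((ContinuousLinearMap.mul ℂ A).flip (CFC.sqrt (a + algebraMap ℝ A ε))))‖ := by
    intro ε hε
    have h0 : 0 ≤ algebraMap ℝ A ε := algebraMap_nonneg A hε.le
    have hsp : IsStrictlyPositive (algebraMap ℝ A ε) :=
      ⟨h0, (IsUnit.mk0 ε hε.ne').map (algebraMap ℝ A)⟩
    obtain ⟨f₁, f₂, h₁, h₂, e, hle⟩ := aux_upper _ (hsp.nonneg_add ha) f hf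
    refine ⟨f₁, f₂, h₁, h₂, e, le_trans ?_ hle⟩
    have p1 := (Complex.le_def.1 (h₁ _ h0)).1
    have p2 := (Complex.le_def.1 (h₂ _ h0)).1
    simp only [map_add, Complex.add_re, Complex.zero_re] at *
    linarith
  have mem : ∀ f₁ f₂ : A →L[ℂ] ℂ, IsPosFunctional f₁ → IsPosFunctional f₂ → f = f₁ - f₂ →
      (f₁ a).re + (f₂ a).re ∈ { r : ℝ | ∃ f₁ f₂ : A →L[ℂ] ℂ, IsPosFunctional f₁ ∧
        IsPosFunctional f₂ ∧ f = f₁ - f₂ ∧ (r : ℂ) = f₁ a + f₂ a } := by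
    intro f₁ f₂ h₁ h₂ e
    refine ⟨f₁, f₂, h₁, h₂, e, ?_⟩
    have p1 := (Complex.le_def.1 (h₁ _ ha)).2
    have p2 := (Complex.le_def.1 (h₂ _ ha)).2
    apply Complex.ext <;> simp [← p1, ← p2]
  have low : ∀ r ∈ { r : ℝ | ∃ f₁ f₂ : A →L[ℂ] ℂ, IsPosFunctional f₁ ∧
        IsPosFunctional f₂ ∧ f = f₁ - f₂ ∧ (r : ℂ) = f₁ a + f₂ a },
      ‖f.comp ((ContinuousLinearMap.mul ℂ A (CFC.sqrt a)).comp
        ((ContinuousLinearMap.mul ℂ A).flip (CFC.sqrt a)))‖ ≤ r := by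
    rintro r ⟨f₁, f₂, h₁, h₂, e, hr⟩
    have := aux_lower a ha f f₁ f₂ hf h₁ h₂ e
    have hr' := congrArg Complex.re hr
    simp at hr'
    rwa [hr']
  unfold rSeminorm
  apply le_antisymm
  · have hT : Filter.Tendsto (fun ε : ℝ => CFC.sqrt (a + algebraMap ℝ A ε))
        (nhdsWithin 0 (Set.Ioi 0)) (nhds (CFC.sqrt a)) := by
      have h1 := (CFC.continuousOn_sqrt (A := A)) a ha
      refine h1.tendsto.comp (tendsto_nhdsWithin_iff.2 ⟨?_, ?_⟩)
      · have : Continuous fun ε : ℝ => a + algebraMap ℝ A ε := by fun_prop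
        have := this.tendsto 0
        simp only [map_zero, add_zero] at this
        exact this.mono_left nhdsWithin_le_nhds
      · filter_upwards [self_mem_nhdsWithin] with ε hε
        exact add_nonneg ha (algebraMap_nonneg A (le_of_lt hε))
    have hC : Continuous fun s : A => ‖f.comp ((ContinuousLinearMap.mul ℂ A s).comp
        ((ContinuousLinearMap.mul ℂ A).flip s))‖ := by fun_prop
    refine ge_of_tendsto ((hC.tendsto _).comp hT) ?_
    filter_upwards [self_mem_nhdsWithin] with ε hε
    obtain ⟨f₁, f₂, h₁, h₂, e, hle⟩ := key ε hε
    exact (csInf_le ⟨_, low⟩ (mem f₁ f₂ h₁ h₂ e)).trans hle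
  · obtain ⟨f₁, f₂, h₁, h₂, e, -⟩ := key 1 one_pos
    exact le_csInf ⟨_, mem f₁ f₂ h₁ h₂ e⟩ low
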